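/- Let a(n) be the cubic partition function. Then for every nonnegative integer n, a(49n+15) ≡ 0 (mod 7). -/

import Mathlib

/-- The cubic partition function: number of pairs of partitions (λ, μ) with
|λ| + |μ| = n where all parts of μ are even. -/
def cubicPartition (n : ℕ) : ℕ :=
  ∑ j ∈ Finset.range (n + 1),
    Fintype.card (Nat.Partition j) *
      Fintype.card {μ : Nat.Partition (n - j) // ∀ i ∈ μ.parts, Even i}

section Algebra

open PowerSeries

variable {R : Type*} [CommRing R] [CharP R 7]

theorem seven_eq_zero_of_charP : (7 : R) = 0 := by
  exact_mod_cast CharP.cast_eq_zero R 7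

theorem derivation_of_cube_eq_one_sub [IsDomain R] {S : Type*} [CommRing S] [Algebra S R]
    (D : Derivation S R R) {Q Δ c : R} (hQ : Q ≠ 0)
    (h : Q ^ 3 = 1 - Δ) (hΔ : D Δ = c * Q ^ 2 * Δ) : D Q = 2 * c * Δ := by
  have h1 := congrArg D h
  rw [D.leibniz_pow, map_sub, hΔ, D.map_one_eq_zero] at h1
  simp only [smul_eq_mul, nsmul_eq_mul] at h1
  have h7 : (7 : R) = 0 := seven_eq_zero_of_charP
  apply mul_left_cancel₀ (pow_ne_zero 2 hQ)
  push_cast at h1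
  linear_combination (-2) * h1 + Q ^ 2 * D Q * h7

theorem exists_pow_seven_and_fixed [IsDomain R] {S : Type*} [CommRing S] [Algebra S R]
    (D : Derivation S R R) {X Q₁ Q₂ F₁ F₂ W : R}
    (hX : D X = X) (hF₁ : D F₁ = 5 * (Q₁ ^ 2 - 1) * F₁)
    (hF₂ : D F₂ = 10 * (Q₂ ^ 2 - 1) * F₂)
    (hQ₁ : Q₁ ^ 3 = 1 - X * F₁ ^ 24) (hQ₂ : Q₂ ^ 3 = 1 - X ^ 2 * F₂ ^ 24)
    (h : (2 * Q₂ - Q₁) ^ 2 * (Q₁ - Q₂) = 2 * (X * F₁ ^ 24))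
    (hX8 : X * (F₁ * F₂) ^ 8 = 4 * (2 * Q₂ - Q₁) * (Q₁ - Q₂))
    (hW : W * (F₁ * F₂) = 1) (hQ₁0 : Q₁ ≠ 0) (hQ₂0 : Q₂ ≠ 0) (T U : R → R)
    (hT : ∀ w, T w = D w - w) (hU : ∀ w, U w = D w + w) :
    ∃ g : R, W - T (T (T (T (T (T W))))) = X * g ^ 7 ∧ U (U (U g)) = g := by
  have h7 : (7 : R) = 0 := seven_eq_zero_of_charP
  have hΔ₁ : D (X * F₁ ^ 24) = 1 * Q₁ ^ 2 * (X * F₁ ^ 24) := by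
    rw [D.leibniz, D.leibniz_pow, hX, hF₁]
    simp only [smul_eq_mul, nsmul_eq_mul]
    push_cast
    linear_combination (17 * (Q₁ ^ 2 - 1) * (X * F₁ ^ 24)) * h7
  have hΔ₂ : D (X ^ 2 * F₂ ^ 24) = 2 * Q₂ ^ 2 * (X ^ 2 * F₂ ^ 24) := by
    rw [D.leibniz, D.leibniz_pow, D.leibniz_pow, hX, hF₂]
    simp only [smul_eq_mul, nsmul_eq_mul]
    push_cast
    linear_combination (34 * (Q₂ ^ 2 - 1) * (X ^ 2 * F₂ ^ 24)) * h7
  have dQ₁ := derivation_of_cube_eq_one_sub D hQ₁0 hQ₁ hΔ₁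
  have dQ₂ := derivation_of_cube_eq_one_sub D hQ₂0 hQ₂ hΔ₂
  obtain ⟨x, hx⟩ : ∃ x, x = 2 * Q₂ - Q₁ := ⟨_, rfl⟩
  obtain ⟨y, hy⟩ : ∃ y, y = 4 * (Q₁ - Q₂) := ⟨_, rfl⟩
  have e₁ : Q₁ = x + 4 * y := by linear_combination (2 * Q₂ - 2 * Q₁) * h7 - hx - 4 * hy
  have e₂ : Q₂ = x + 2 * y := by linear_combination (Q₂ - Q₁) * h7 - hx - 2 * hy
  rw [← hx] at h hX8
  have hxy : x ^ 2 * y = X * F₁ ^ 24 := by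
    linear_combination 4 * h + x ^ 2 * hy + X * F₁ ^ 24 * h7
  have hcub : (x ^ 2 - y ^ 2) * (x - y) = 1 := by grind
  have hxy2 : x * y ^ 2 = X ^ 2 * F₂ ^ 24 := by grind
  have dx : D x = x * y ^ 2 - 2 * x ^ 2 * y := by
    have : D x = 2 * D Q₂ - D Q₁ := by rw [hx]; simp [two_mul]
    rw [this, dQ₁, dQ₂, ← hxy, ← hxy2]
    linear_combination x * y ^ 2 * h7
  have dy : D y = x ^ 2 * y - 2 * x * y ^ 2 := by
    have : D y = 4 * (D Q₁ - D Q₂) := by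
      have h4 : (4 : R) * (Q₁ - Q₂) = (4 : ℕ) • (Q₁ - Q₂) := by simp
      rw [hy, h4, map_nsmul, map_sub]; simp
    rw [this, dQ₁, dQ₂, ← hxy, ← hxy2]
    linear_combination (x ^ 2 * y - 2 * x * y ^ 2) * h7
  obtain ⟨e, he⟩ : ∃ e, e = F₁ * F₂ := ⟨_, rfl⟩
  rw [← he] at hW hX8
  have de : D e = e * (5 * Q₁ ^ 2 + 10 * Q₂ ^ 2 - 15) := by
    rw [he, D.leibniz, hF₁, hF₂]; simp only [smul_eq_mul]; ring
  obtain ⟨A, hA⟩ : ∃ A, A = x ^ 2 - y ^ 2 := ⟨_, rfl⟩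
  obtain ⟨b, hb⟩ : ∃ b, b = x - y := ⟨_, rfl⟩
  have hAb : A * b = 1 := by rw [hA, hb, hcub]
  have hA2 : A ^ 2 = x + y := by
    linear_combination (x + y) * hcub + A * hA + (x ^ 2 - y ^ 2) * hA
  have hX8' : X * e ^ 8 = 2 * (A ^ 4 - b ^ 2) := by
    linear_combination hX8 - x * hy - (b + x - y) * (-2) * hb -
      2 * (A ^ 2 + x + y) * hA2 - x * y * h7
  have dA : D A = b - A ^ 5 := by
    have : D A = 2 * x * D x - 2 * y * D y := by
      rw [hA, map_sub, D.leibniz_pow, D.leibniz_pow]; simp; ring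
    rw [this, dx, dy]
    clear * - hA2 hb hAb hA
    grind
  have de' : D e = e * (5 * b ^ 2 + 3 * A ^ 4 - 1) := by
    rw [de, e₁, e₂]
    clear * - hA2 hb
    grind
  clear hX8 de he hF₁ hF₂ hQ₁ hQ₂ h hQ₁0 hQ₂0 hΔ₁ hΔ₂ dQ₁ dQ₂ hx hy
    e₁ e₂ hxy hxy2 dx dy hX hcub hA2 hA hb
  have dW : D W = W * (1 - 5 * b ^ 2 - 3 * A ^ 4) := by
    have h1 := congrArg D hW
    rw [D.leibniz, D.map_one_eq_zero, de'] at h1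
    simp only [smul_eq_mul] at h1
    linear_combination (-D W + W * (1 - 5 * b ^ 2 - 3 * A ^ 4)) * hW + W * h1
  have dApow (n : ℕ) : D (A ^ (n + 2)) = (n + 2) * (A ^ n - A ^ (n + 6)) := by
    rw [D.leibniz_pow, dA]
    simp only [smul_eq_mul, nsmul_eq_mul]
    push_cast
    linear_combination (n + 2) * A ^ n * hAb
  have dc (n : ℕ) : D (n : R) = 0 := by simp
  have db : D b = b * (A ^ 4 - b ^ 2) := by
    have h1 := congrArg D hAb
    rw [D.leibniz, D.map_one_eq_zero, dA] at h1
    simp only [smul_eq_mul] at h1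
    linear_combination (-D b + b * (A ^ 4 - b ^ 2) + b ^ 3) * hAb + b * h1
  obtain ⟨V, hV⟩ : ∃ V, V = T W := ⟨_, rfl⟩
  have hVW : V = W * (4 * A ^ 4 + 2 * b ^ 2) := by
    rw [hV, hT, dW]; linear_combination (-W * (A ^ 4 + b ^ 2)) * h7
  have hTV : T V = A ^ 2 * W := by
    have h1 : D V = D W * (4 * A ^ 4 + 2 * b ^ 2) + W * (16 * (A ^ 2 - A ^ 8) + 4 * b * D b) := by
      have h2 : D (4 * A ^ 4 + 2 * b ^ 2) = 16 * (A ^ 2 - A ^ 8) + 4 * b * D b := by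
        rw [map_add, D.leibniz, D.leibniz, dApow 2, D.leibniz_pow b]
        have h4 := dc 4
        have h2 := dc 2
        push_cast at h2 h4
        rw [h4, h2]
        simp only [smul_eq_mul, nsmul_eq_mul]
        push_cast
        ring
      rw [hVW, D.leibniz, h2]; simp only [smul_eq_mul]; ring
    rw [hT, h1, hVW, dW, db]
    clear * - hAb
    grind
  have hTc (p q : R) : T (p * W + q * V) = (D p + A ^ 2 * q) * W + (D q + p) * V := by
    have h1 : D W = V + W := by rw [hV, hT]; ring
    have h2 : D V = A ^ 2 * W + V := by rw [← hTV, hT]; ring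
    rw [hT, map_add, D.leibniz, D.leibniz, h1, h2]; simp only [smul_eq_mul]; ring
  have dcpow (m n : ℕ) : D ((m : R) * A ^ (n + 2)) = m * ((n + 2) * (A ^ n - A ^ (n + 6))) := by
    rw [D.leibniz, dc, dApow]; simp
  have T3 : T (A ^ 2 * W) = (2 - 2 * A ^ 6) * W + A ^ 2 * V := by
    have h1 := hTc (A ^ 2) 0
    have h2 := dApow 0
    simp only [map_zero, zero_mul, mul_zero, zero_add, add_zero] at h1
    push_cast at h2
    linear_combination (exp := 1) h1 + W * h2
  have T4 : T ((2 - 2 * A ^ 6) * W + A ^ 2 * V) =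
      (3 * A ^ 4 - 2 * A ^ 10) * W + 4 * (1 - A ^ 6) * V := by
    have h1 := hTc (2 - 2 * A ^ 6) (A ^ 2)
    have h2 := dcpow 2 4
    have h3 := dcpow 1 0
    have h4 := dc 2
    rw [map_sub] at h1
    push_cast [one_mul] at h2 h3 h4
    rw [h1, h2, h3, h4]
    clear * - hAb
    grind
  have T5 : T ((3 * A ^ 4 - 2 * A ^ 10) * W + 4 * (1 - A ^ 6) * V) =
      (2 * A ^ 2 - A ^ 8 - A ^ 14) * W + A ^ 10 * V := by
    have h1 := hTc (3 * A ^ 4 - 2 * A ^ 10) (4 - 4 * A ^ 6)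
    have h2 := dcpow 3 2
    have h3 := dcpow 2 8
    have h4 := dcpow 4 4
    have h5 := dc 4
    rw [map_sub, map_sub] at h1
    push_cast at h2 h3 h4 h5
    rw [mul_one_sub, h1, h2, h3, h4, h5]
    clear * - hAb
    grind
  have T6 : T ((2 * A ^ 2 - A ^ 8 - A ^ 14) * W + A ^ 10 * V) =
      (4 - 5 * A ^ 6 + 2 * A ^ 12) * W + (2 * A ^ 2 + 2 * A ^ 8 - 4 * A ^ 14) * V := by
    have h1 := hTc (2 * A ^ 2 - A ^ 8 - A ^ 14) (A ^ 10)
    have h2 := dcpow 2 0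
    rw [map_sub, map_sub] at h1
    push_cast at h2
    rw [h1, h2, dApow 6, dApow 12, dApow 8]
    push_cast
    clear * - hAb
    grind
  refine ⟨A ^ 2 * e, ?_, ?_⟩
  · rw [← hV, hTV, T3, T4, T5, T6, hVW]
    have h1 : X * (A ^ 2 * e) ^ 7 = 2 * A ^ 14 * (A ^ 4 - b ^ 2) * W := by
      linear_combination A ^ 14 * W * hX8' - X * A ^ 14 * e ^ 7 * hW
    rw [h1]
    clear * - hAb
    grind
  · have hUc (c n : ℕ) : U (c * (e * A ^ (n + 2))) =
        c * (e * (n * A ^ n + (1 - n) * A ^ (n + 6))) := by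
      rw [hU, D.leibniz, dc, D.leibniz, dApow, de']
      simp only [smul_eq_mul]
      linear_combination (5 * c * e * A ^ n * (A * b + 1)) * hAb + c * e * A ^ n * h7
    have hUadd (p q : R) : U (p + q) = U p + U q := by simp only [hU, map_add]; ring
    have u1 := hUc 1 0
    have u2 := hUc 1 4
    have u3 := hUc 4 2
    have u4 := hUc 4 8
    push_cast at u1 u2 u3 u4
    have e1 : A ^ 2 * e = 1 * (e * A ^ (0 + 2)) := by ring
    have e2 : 1 * (e * (0 * A ^ 0 + (1 - 0) * A ^ (0 + 6))) = 1 * (e * A ^ (4 + 2)) := by ring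
    have e3 : 1 * (e * (4 * A ^ 4 + (1 - 4) * A ^ (4 + 6))) =
        4 * (e * A ^ (2 + 2)) + 4 * (e * A ^ (8 + 2)) := by
      linear_combination -e * A ^ 10 * h7
    rw [e1, u1, e2, u2, e3, hUadd, u3, u4]
    linear_combination (e * A ^ 2 + 4 * e * A ^ 8 - 4 * e * A ^ 14) * h7
end Algebra

section PowerSeriesModSeven

open PowerSeries

local instance : Fact (Nat.Prime 7) := ⟨by norm_num⟩

/-- The derivation `X · d/dX` on power series. -/
noncomputable def eulerDerivation (R : Type*) [CommRing R] : Derivation R R⟦X⟧ R⟦X⟧ :=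
  (X : R⟦X⟧) • derivative R

theorem coeff_eulerDerivation {R : Type*} [CommRing R] (f : R⟦X⟧) (n : ℕ) :
    coeff n (eulerDerivation R f) = n * coeff n f := by
  have h : eulerDerivation R f = X * derivative R f := rfl
  rw [h]
  cases n with
  | zero => simp
  | succ n => rw [coeff_succ_X_mul, coeff_derivative]; push_cast; ring

theorem eulerDerivation_expand {R : Type*} [CommRing R] (p : ℕ) (hp : p ≠ 0) (f : R⟦X⟧) :
    eulerDerivation R (expand p hp f) = p * expand p hp (eulerDerivation R f) := by
  have h : ((p : ℕ) : R⟦X⟧) = C (p : R) := by simp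
  ext n
  rw [coeff_eulerDerivation, h, coeff_C_mul, coeff_expand, coeff_expand]
  split_ifs with hd
  · obtain ⟨m, rfl⟩ := hd
    rw [coeff_eulerDerivation, Nat.mul_div_cancel_left m (Nat.pos_of_ne_zero hp)]
    push_cast; ring
  · simp

instance PowerSeries.charP_of_charP (R : Type*) [CommRing R] (p : ℕ) [CharP R p] :
    CharP R⟦X⟧ p := charP_of_injective_ringHom (f := C (R := R)) C_injective p

theorem pow_prime_eq_expand (p : ℕ) [hp : Fact p.Prime] (g : (ZMod p)⟦X⟧) :
    g ^ p = expand p hp.out.ne_zero g := by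
  have h := MvPowerSeries.map_frobenius_expand (R := ZMod p) p hp.out.ne_zero (f := g)
  rw [ZMod.frobenius_zmod] at h
  rw [← h]
  exact congrFun (congrArg DFunLike.coe MvPowerSeries.map_id) _

theorem coeff_eq_zero_of_ramanujan_mod_seven {Q F W : (ZMod 7)⟦X⟧}
    (hF : eulerDerivation _ F = 5 * (Q ^ 2 - 1) * F) (hQ : Q ^ 3 = 1 - X * F ^ 24)
    (h : (2 * expand 2 two_ne_zero Q - Q) ^ 2 * (Q - expand 2 two_ne_zero Q) = 2 * (X * F ^ 24))
    (hQ0 : coeff 0 Q = 1) (hQ1 : coeff 1 Q = 2) (hF0 : coeff 0 F = 1)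
    (hW : W * (F * expand 2 two_ne_zero F) = 1) (n : ℕ) : coeff (49 * n + 15) W = 0 := by
  obtain ⟨Q₂, hQ₂⟩ : ∃ Q₂, Q₂ = expand 2 two_ne_zero Q := ⟨_, rfl⟩
  obtain ⟨F₂, hF₂⟩ : ∃ F₂, F₂ = expand 2 two_ne_zero F := ⟨_, rfl⟩
  have hQ₂0 : coeff 0 Q₂ = 1 := by rw [hQ₂]; simpa [coeff_expand] using hQ0
  have hQ₂1 : coeff 1 Q₂ = 0 := by rw [hQ₂]; simp [coeff_expand]
  have hF₂0 : coeff 0 F₂ = 1 := by rw [hF₂]; simpa [coeff_expand] using hF0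
  have hDX : eulerDerivation (ZMod 7) X = X := by
    ext n; rw [coeff_eulerDerivation, coeff_X]; split_ifs with h <;> simp [h]
  have hDF₂ : eulerDerivation (ZMod 7) F₂ = 10 * (Q₂ ^ 2 - 1) * F₂ := by
    rw [hF₂, eulerDerivation_expand, hF, hQ₂]
    simp only [map_mul, map_sub, map_pow, map_one, map_ofNat]
    push_cast; ring
  have hQ₂3 : Q₂ ^ 3 = 1 - X ^ 2 * F₂ ^ 24 := by
    have := congrArg (expand 2 two_ne_zero) hQ
    simpa [← hQ₂, ← hF₂] using this
  rw [← hQ₂] at h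
  rw [← hF₂] at hW
  have hX8 : X * (F * F₂) ^ 8 = 4 * (2 * Q₂ - Q) * (Q - Q₂) := by
    obtain ⟨c, hc⟩ : ∃ c, c = 4 * (2 * Q₂ - Q) * (Q - Q₂) := ⟨_, rfl⟩
    obtain ⟨a, ha⟩ : ∃ a, a = X * (F * F₂) ^ 8 := ⟨_, rfl⟩
    have ha1 : coeff 1 a = 1 := by
      rw [ha, show 1 = 0 + 1 from rfl, coeff_succ_X_mul]
      simp only [coeff_zero_eq_constantCoeff, map_pow, map_mul] at hF0 hF₂0 ⊢
      simp [hF0, hF₂0]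
    have hc1 : coeff 1 c = 1 := by
      have h4 : (4 : (ZMod 7)⟦X⟧) = C 4 := (map_ofNat C 4).symm
      have h2 : (2 : (ZMod 7)⟦X⟧) = C 2 := (map_ofNat C 2).symm
      rw [hc, mul_assoc, h4, h2, coeff_C_mul, coeff_mul]
      simp [Finset.Nat.antidiagonal_succ, coeff_C_mul, hQ1, hQ₂1] at *
      simp [hQ0, hQ₂0]
      decide
    have h3 : a ^ 3 = c ^ 3 := by
      have h7 : (7 : (ZMod 7)⟦X⟧) = 0 := seven_eq_zero_of_charP
      have h2 : X ^ 2 * F₂ ^ 24 = (2 * Q₂ - Q) * (4 * (Q - Q₂)) ^ 2 := by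
        generalize X * F ^ 24 = d₁ at hQ h
        generalize X ^ 2 * F₂ ^ 24 = d₂ at hQ₂3 ⊢
        clear * - hQ h hQ₂3
        grind
      have h1 : X * F ^ 24 = (2 * Q₂ - Q) ^ 2 * (4 * (Q - Q₂)) := by
        linear_combination -X * F ^ 24 * h7 - 4 * h
      rw [ha, hc]
      linear_combination X ^ 2 * F₂ ^ 24 * h1 + (2 * Q₂ - Q) ^ 2 * (4 * (Q - Q₂)) * h2
    have h7 : (7 : (ZMod 7)⟦X⟧) = 0 := seven_eq_zero_of_charP
    have hprod : (a - c) * ((a - 2 * c) * (a - 4 * c)) = 0 := by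
      linear_combination h3 + (- a ^ 2 * c + 2 * a * c ^ 2 - c ^ 3) * h7
    have hne (k : ZMod 7) (hk : k ≠ 1) : a - C k * c ≠ 0 := by
      intro h0
      have := congrArg (coeff 1) h0
      simp only [map_sub, coeff_C_mul, ha1, hc1, map_zero, mul_one] at this
      exact hk (sub_eq_zero.mp this).symm
    have h2 := hne 2 (by decide)
    have h4 := hne 4 (by decide)
    rw [map_ofNat] at h2 h4
    rw [← ha, ← hc]
    exact sub_eq_zero.mp ((mul_eq_zero.mp hprod).resolve_right (mul_ne_zero h2 h4))
  let D := eulerDerivation (ZMod 7)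
  have hD (f : (ZMod 7)⟦X⟧) (m : ℕ) : coeff m (D f) = m * coeff m f := coeff_eulerDerivation f m
  obtain ⟨g, hg₁, hg₂⟩ := exists_pow_seven_and_fixed (R := (ZMod 7)⟦X⟧) D hDX hF
    hDF₂ hQ hQ₂3 h hX8 hW
    (by rintro rfl; simp at hQ0) (by rintro rfl; simp at hQ₂0)
    (fun w => D w - w) (fun w => D w + w) (fun _ => rfl) (fun _ => rfl)
  have hg0 : coeff (7 * n + 2) g = 0 := by
    have h1 := congrArg (coeff (7 * n + 2)) hg₂
    simp only [map_add, hD] at h1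
    have h7 : (7 : ZMod 7) = 0 := rfl
    push_cast at h1
    rw [h7] at h1
    have h2 : (26 : ZMod 7) * coeff (7 * n + 2) g = 0 := by linear_combination h1
    exact (mul_eq_zero.mp h2).resolve_left (by decide)
  have h1 := congrArg (coeff (7 * (7 * n + 2) + 1)) hg₁
  rw [coeff_succ_X_mul, pow_prime_eq_expand, coeff_expand_mul, hg0] at h1
  simp only [map_sub, hD] at h1
  push_cast at h1
  have h7 : (7 : ZMod 7) = 0 := rfl
  rw [h7] at h1
  rw [show 49 * n + 15 = 7 * (7 * n + 2) + 1 by ring]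
  linear_combination h1

end PowerSeriesModSeven

section EulerFunction

open PowerSeries Finset Filter
open scoped PowerSeries.WithPiTopology

variable (R : Type*) [CommRing R]

theorem expand_mk_one_mul_one_sub (i : ℕ) :
    expand (i + 1) i.succ_ne_zero (mk 1 : R⟦X⟧) * (1 - X ^ (i + 1)) = 1 := by
  have h := congrArg (expand (i + 1) i.succ_ne_zero) (mk_one_mul_one_sub_eq_one R)
  simpa using h

theorem eulerDerivation_prod_one_sub_X_pow (N : ℕ) :
    eulerDerivation R (∏ i ∈ range N, (1 - X ^ (i + 1))) =
      -(∏ i ∈ range N, (1 - X ^ (i + 1))) *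
        ∑ i ∈ range N, C ((i : R) + 1) * (expand (i + 1) i.succ_ne_zero (mk 1 : R⟦X⟧) - 1) := by
  induction N with
  | zero => simp
  | succ N ih =>
    have hX : eulerDerivation R (1 - X ^ (N + 1) : R⟦X⟧) = -C ((N : R) + 1) * X ^ (N + 1) := by
      ext n
      rw [coeff_eulerDerivation, neg_mul, map_neg, coeff_C_mul, map_sub, coeff_X_pow, coeff_one]
      split_ifs <;> simp_all
    rw [prod_range_succ, sum_range_succ, Derivation.leibniz, ih, hX]
    simp only [smul_eq_mul]
    linear_combination (C ((N : R) + 1) * (∏ i ∈ range N, (1 - X ^ (i + 1)))) *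
      expand_mk_one_mul_one_sub R N

theorem coeff_sum_expand_mk_one {n N : ℕ} (h : n ≤ N) :
    coeff n (∑ i ∈ range N, C ((i : R) + 1) * (expand (i + 1) i.succ_ne_zero (mk 1 : R⟦X⟧) - 1)) =
      (ArithmeticFunction.sigma 1 n : R) := by
  rw [map_sum]
  simp only [coeff_C_mul, map_sub, coeff_expand, coeff_one]
  rcases Nat.eq_zero_or_pos n with rfl | hn
  · simp
  · have hd : n.divisors = ((range N).filter (· + 1 ∣ n)).map ⟨(· + 1), add_left_injective 1⟩ := by
      ext d
      simp only [Nat.mem_divisors, Finset.mem_map, mem_filter, mem_range,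
        Function.Embedding.coeFn_mk]
      constructor
      · rintro ⟨hdn, -⟩
        have h1 := Nat.pos_of_dvd_of_pos hdn hn
        have h2 := Nat.le_of_dvd hn hdn
        exact ⟨d - 1, ⟨by omega, by rwa [Nat.sub_add_cancel h1]⟩, by omega⟩
      · rintro ⟨i, ⟨-, hi⟩, rfl⟩
        exact ⟨hi, hn.ne'⟩
    rw [ArithmeticFunction.sigma_one_apply, hd, sum_map, Nat.cast_sum, sum_filter]
    refine sum_congr rfl fun i _ => ?_
    rw [if_neg hn.ne']
    split_ifs <;> simp

theorem eventually_coeff_prod_range_eq (n : ℕ) :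
    ∀ᶠ N in atTop, ∀ m ≤ n, coeff m (∏ i ∈ range N, (1 - X ^ (i + 1) : R⟦X⟧)) =
      coeff m (pentagonalSeries R) := by
  have h := (eventually_all_finset (range (n + 1))).mpr fun m _ =>
    tendsto_finset_range.eventually (coeff_prod_one_sub_X_pow_eventually_eq R m)
  filter_upwards [h] with N hN m hm using hN m (by simpa [Nat.lt_succ_iff] using hm)

theorem eulerDerivation_pentagonalSeries :
    eulerDerivation R (pentagonalSeries R) =
      -pentagonalSeries R * mk fun n => (ArithmeticFunction.sigma 1 n : R) := by
  ext n
  obtain ⟨N, hN, hnN⟩ := ((eventually_coeff_prod_range_eq R n).and (eventually_ge_atTop n)).exists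
  have h := congrArg (coeff n) (eulerDerivation_prod_one_sub_X_pow R N)
  rw [coeff_eulerDerivation, hN n le_rfl, neg_mul, map_neg, coeff_mul] at h
  rw [coeff_eulerDerivation, h, neg_mul, map_neg, coeff_mul]
  congr 1
  refine sum_congr rfl fun p hp => ?_
  have hp := mem_antidiagonal.mp hp
  rw [hN p.1 (by omega), coeff_sum_expand_mk_one R (by omega), coeff_mk]

theorem coeff_zero_pentagonalSeries : coeff 0 (pentagonalSeries R) = 1 := by
  obtain ⟨N, hN⟩ := (eventually_coeff_prod_range_eq R 0).exists
  rw [← hN 0 le_rfl, coeff_zero_eq_constantCoeff, map_prod]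
  simp

theorem map_pentagonalSeries {S : Type*} [CommRing S] (f : R →+* S) :
    (pentagonalSeries R).map f = pentagonalSeries S := by
  ext n
  obtain ⟨N, hN, hN'⟩ :=
    ((eventually_coeff_prod_range_eq R n).and (eventually_coeff_prod_range_eq S n)).exists
  rw [coeff_map, ← hN n le_rfl, ← hN' n le_rfl, ← coeff_map, map_prod]
  simp

open PowerSeries.WithPiTopology Nat.Partition in
theorem mk_card_restricted_mul_eq_one [TopologicalSpace R] [IsTopologicalRing R] [T2Space R]
    (p : ℕ → Prop) [DecidablePred p] {f : R⟦X⟧}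
    (hf : HasProd (fun i => if p (i + 1) then (1 - X ^ (i + 1) : R⟦X⟧) else 1) f) :
    (mk fun n => (#(restricted n p) : R)) * f = 1 := by
  have h := (hasProd_powerSeriesMk_card_restricted R p).mul hf
  have h1 : (fun i => (if p (i + 1) then ∑' j : ℕ, X ^ ((i + 1) * j) else 1) *
      (if p (i + 1) then (1 - X ^ (i + 1) : R⟦X⟧) else 1)) = fun _ => 1 := by
    ext1 i
    split_ifs
    · simp_rw [pow_mul]
      exact tsum_pow_mul_one_sub_of_constantCoeff_eq_zero (by simp)
    · simp
  rw [h1] at h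
  exact h.unique hasProd_one

theorem mk_cubicPartition_mul_eq_one :
    (mk fun n => (cubicPartition n : R)) *
      (pentagonalSeries R * expand 2 two_ne_zero (pentagonalSeries R)) = 1 := by
  let _ : TopologicalSpace R := ⊥
  have : DiscreteTopology R := ⟨rfl⟩
  have h1 : HasProd (fun i => if True then (1 - X ^ (i + 1) : R⟦X⟧) else 1)
      (pentagonalSeries R) := by
    simpa using WithPiTopology.hasProd_one_sub_X_pow R
  have hcont : Continuous (expand 2 two_ne_zero : R⟦X⟧ →ₐ[R] R⟦X⟧) := by
    rw [continuous_iff_continuousAt]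
    intro f
    rw [ContinuousAt, WithPiTopology.tendsto_iff_coeff_tendsto]
    intro n
    simp only [coeff_expand]
    split_ifs
    · exact (WithPiTopology.continuous_coeff R _).tendsto f
    · exact tendsto_const_nhds
  have h2 : HasProd (fun i => if Even (i + 1) then (1 - X ^ (i + 1) : R⟦X⟧) else 1)
      (expand 2 two_ne_zero (pentagonalSeries R)) := by
    have hinj : Function.Injective fun i : ℕ => 2 * i + 1 := fun a b h => by simpa using h
    rw [← hinj.hasProd_iff]
    · convert (WithPiTopology.hasProd_one_sub_X_pow R).map _ hcont using 1
      ext1 i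
      have h : Even (2 * i + 1 + 1) := ⟨i + 1, by ring⟩
      simp [h, ← pow_mul, mul_add, add_assoc]
    · intro x hx
      rw [if_neg]
      intro ⟨k, hk⟩
      exact hx ⟨k - 1, by dsimp only; omega⟩
  have g1 := mk_card_restricted_mul_eq_one R (fun _ => True) h1
  have g2 := mk_card_restricted_mul_eq_one R Even h2
  have hc : (mk fun n => (cubicPartition n : R)) =
      (mk fun n => (#(Nat.Partition.restricted n fun _ => True) : R)) *
        mk fun n => (#(Nat.Partition.restricted n Even) : R) := by
    ext n
    rw [coeff_mul, coeff_mk, Finset.Nat.sum_antidiagonal_eq_sum_range_succ_mk, cubicPartition]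
    push_cast
    refine sum_congr rfl fun j _ => ?_
    simp only [coeff_mk, Nat.Partition.restricted, implies_true, filter_true, card_univ,
      Fintype.card_subtype]
  rw [hc]
  linear_combination g1 * (mk fun n => (#(Nat.Partition.restricted n Even) : R)) *
    expand 2 two_ne_zero (pentagonalSeries R) + g2

end EulerFunction

section QSeries

open PowerSeries UpperHalfPlane ModularForm ModularFormClass MatrixGroups EisensteinSeries Finset

local notation "𝕢" => Function.Periodic.qParam

theorem norm_coeff_prod_one_sub_X_pow_mul_pow_le {ρ : ℝ} (hρ : 0 ≤ ρ) (N m : ℕ) :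
    ‖coeff m (∏ i ∈ range N, (1 - X ^ (i + 1) : ℂ⟦X⟧))‖ * ρ ^ m ≤
      ∏ i ∈ range N, (1 + ρ ^ (i + 1)) := by
  induction N generalizing m with
  | zero =>
    rcases m with - | m <;> simp [coeff_one]
  | succ N ih =>
    have h0 : 0 ≤ ∏ i ∈ range N, (1 + ρ ^ (i + 1)) := prod_nonneg fun i _ ↦ by positivity
    rw [prod_range_succ, prod_range_succ, mul_one_sub, map_sub, coeff_mul_X_pow', mul_one_add]
    split_ifs with h
    · have h1 := mul_le_mul_of_nonneg_right (ih (m - (N + 1))) (pow_nonneg hρ (N + 1))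
      rw [mul_assoc, ← pow_add, Nat.sub_add_cancel h] at h1
      have h2 := mul_le_mul_of_nonneg_right (norm_sub_le
        (coeff m (∏ i ∈ range N, (1 - X ^ (i + 1) : ℂ⟦X⟧)))
        (coeff (m - (N + 1)) (∏ i ∈ range N, (1 - X ^ (i + 1) : ℂ⟦X⟧)))) (pow_nonneg hρ m)
      linarith [ih m]
    · rw [sub_zero]
      exact (ih m).trans (le_add_of_nonneg_right (by positivity))

/-- The power series `a`, evaluated at `q = exp (2 π i τ)`, converges to `f τ` on the upper half
plane. -/
def HasQSeries (a : ℂ⟦X⟧) (f : ℍ → ℂ) : Prop :=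
  ∀ τ : ℍ, HasSum (fun m : ℕ ↦ coeff m a • 𝕢 1 τ ^ m) (f τ)

namespace HasQSeries

variable {a b : ℂ⟦X⟧} {f g : ℍ → ℂ}

theorem sub (ha : HasQSeries a f) (hb : HasQSeries b g) : HasQSeries (a - b) (f - g) := fun τ ↦ by
  simpa [sub_mul] using (ha τ).sub (hb τ)

theorem C_mul (c : ℂ) (ha : HasQSeries a f) : HasQSeries (C c * a) (fun τ ↦ c * f τ) := fun τ ↦ by
  simpa [mul_assoc] using (ha τ).mul_left c

theorem mul (ha : HasQSeries a f) (hb : HasQSeries b g) : HasQSeries (a * b) (f * g) := fun τ ↦ by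
  have hsa := summable_norm_iff.mpr (ha τ).summable
  have hsb := summable_norm_iff.mpr (hb τ).summable
  have hs := (summable_norm_sum_mul_antidiagonal_of_summable_norm hsa hsb).of_norm.hasSum
  rw [← tsum_mul_tsum_eq_tsum_sum_antidiagonal_of_summable_norm hsa hsb, (ha τ).tsum_eq,
    (hb τ).tsum_eq] at hs
  refine hs.congr_fun fun m ↦ ?_
  rw [coeff_mul, sum_smul]
  refine sum_congr rfl fun p hp ↦ ?_
  rw [← mem_antidiagonal.mp hp, pow_add]
  simp only [smul_eq_mul]
  ring

theorem pow (ha : HasQSeries a f) (n : ℕ) : HasQSeries (a ^ (n + 1)) (f ^ (n + 1)) := by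
  induction n with
  | zero => simpa using ha
  | succ n ih => rw [pow_succ, pow_succ f]; exact ih.mul ha

theorem eq (ha : HasQSeries a f) (hb : HasQSeries b f) : a = b := by
  have h : HasQSeries (a - b) 0 := by simpa using ha.sub hb
  ext m
  have := ModularFormClass.qExpansion_coeff_unique (f := (0 : ModularForm 𝒮ℒ 0)) one_pos
    one_mem_strictPeriods_SL h m
  rw [FunLike.coe_zero, qExpansion_zero, map_zero, map_sub, sub_eq_zero] at this
  exact this

theorem X : HasQSeries (X : ℂ⟦X⟧) (fun τ ↦ 𝕢 1 τ) := fun τ ↦ by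
  convert hasSum_ite_eq 1 (𝕢 1 τ) using 2 with m
  rw [coeff_X]
  split_ifs with h
  · rw [h, one_smul, pow_one]
  · rw [zero_smul]

theorem expand_two (ha : HasQSeries a f) {g : ℍ → ℂ}
    (h : ∀ τ τ' : ℍ, (τ' : ℂ) = 2 * τ → g τ = f τ') :
    HasQSeries (expand 2 two_ne_zero a) g := fun τ ↦ by
  obtain ⟨τ', hτ'⟩ : ∃ τ' : ℍ, (τ' : ℂ) = 2 * τ := ⟨⟨2 * τ, by simpa using τ.2⟩, rfl⟩
  have hq : 𝕢 1 τ' = 𝕢 1 τ ^ 2 := by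
    rw [hτ', Function.Periodic.qParam, Function.Periodic.qParam, ← Complex.exp_nat_mul]
    congr 1
    push_cast
    ring
  have hs := ha τ'
  rw [← h τ τ' hτ'] at hs
  refine (Function.Injective.hasSum_iff
    (f := fun m : ℕ ↦ coeff m (expand 2 two_ne_zero a) • 𝕢 1 τ ^ m)
    (mul_right_injective₀ two_ne_zero) ?_).mp (hs.congr_fun fun m ↦ ?_)
  · intro m hm
    rw [coeff_expand_of_not_dvd, zero_smul]
    rintro ⟨k, rfl⟩
    exact hm ⟨k, rfl⟩
  · rw [Function.comp_apply, coeff_expand_mul, hq, pow_mul]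

theorem one : HasQSeries 1 1 := fun τ ↦ by
  refine (hasSum_ite_eq 0 (1 : ℂ)).congr_fun fun m ↦ ?_
  rw [coeff_one]
  split_ifs with h
  · rw [h, one_smul, pow_zero]
  · rw [zero_smul]

theorem prod_one_sub_X_pow (N : ℕ) :
    HasQSeries (∏ i ∈ range N, (1 - PowerSeries.X ^ (i + 1)))
      (∏ i ∈ range N, (1 - (fun τ : ℍ ↦ 𝕢 1 τ) ^ (i + 1))) := by
  induction N with
  | zero => simpa using one
  | succ N ih => rw [prod_range_succ, prod_range_succ]; exact ih.mul (one.sub (X.pow N))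

theorem pentagonalSeries :
    HasQSeries (pentagonalSeries ℂ) (fun τ ↦ ∏' n, (1 - eta_q n τ)) := fun τ ↦ by
  have hq : ‖𝕢 1 (τ : ℂ)‖ < 1 := mod_cast norm_qParam_lt_one 1 τ
  obtain ⟨ρ, hqρ, hρ1⟩ := exists_between hq
  have hρ0 : 0 < ρ := (norm_nonneg _).trans_lt hqρ
  let c := Real.exp (∑' i : ℕ, ρ ^ (i + 1))
  have hs : Summable fun i : ℕ ↦ ρ ^ (i + 1) :=
    (summable_nat_add_iff 1).mpr (summable_geometric_of_lt_one hρ0.le hρ1)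
  have hb (N m : ℕ) : ‖coeff m (∏ i ∈ range N, (1 - PowerSeries.X ^ (i + 1) : ℂ⟦X⟧)) •
      𝕢 1 (τ : ℂ) ^ m‖ ≤ c * (‖𝕢 1 (τ : ℂ)‖ / ρ) ^ m := by
    have h1 := norm_coeff_prod_one_sub_X_pow_mul_pow_le hρ0.le N m
    have h2 : ∏ i ∈ range N, (1 + ρ ^ (i + 1)) ≤ c := by
      refine (prod_le_prod (fun i _ ↦ by positivity)
        (fun i _ ↦ (add_comm _ _).trans_le (Real.add_one_le_exp (ρ ^ (i + 1))))).trans ?_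
      rw [← Real.exp_sum]
      exact Real.exp_le_exp.mpr (hs.sum_le_tsum _ fun i _ ↦ by positivity)
    rw [norm_smul, norm_pow, div_pow, mul_div_assoc', le_div_iff₀ (by positivity)]
    calc _ = ‖coeff m (∏ i ∈ range N, (1 - PowerSeries.X ^ (i + 1) : ℂ⟦X⟧))‖ * ρ ^ m *
          ‖𝕢 1 (τ : ℂ)‖ ^ m := by ring
      _ ≤ _ := by gcongr; exact h1.trans h2
  have hg : Summable fun m : ℕ ↦ c * (‖𝕢 1 (τ : ℂ)‖ / ρ) ^ m :=
    (summable_geometric_of_lt_one (by positivity) ((div_lt_one hρ0).mpr hqρ)).mul_left c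
  have hev (m : ℕ) := eventually_coeff_prod_range_eq ℂ m
  have hlim := tendsto_tsum_of_dominated_convergence (𝓕 := Filter.atTop)
    (f := fun N m ↦ coeff m (∏ i ∈ range N, (1 - PowerSeries.X ^ (i + 1) : ℂ⟦X⟧)) •
      𝕢 1 (τ : ℂ) ^ m)
    (g := fun m ↦ coeff m (PowerSeries.pentagonalSeries ℂ) • 𝕢 1 (τ : ℂ) ^ m) hg
    (fun m ↦ tendsto_const_nhds.congr' <| (hev m).mono fun N hN ↦ by simp only [hN m le_rfl])
    (.of_forall hb)
  have hsum : Summable fun m ↦ coeff m (PowerSeries.pentagonalSeries ℂ) • 𝕢 1 (τ : ℂ) ^ m :=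
    .of_norm_bounded hg fun m ↦ by
      obtain ⟨N, hN⟩ := (hev m).exists
      rw [← hN m le_rfl]
      exact hb N m
  have hprod := (multipliable_one_sub_pow hq).tendsto_prod_tprod_nat
  convert hsum.hasSum using 1
  · refine tendsto_nhds_unique hprod (hlim.congr fun N ↦ ?_)
    rw [(prod_one_sub_X_pow N τ).tsum_eq]
    simp

theorem discriminant :
    HasQSeries (PowerSeries.X * PowerSeries.pentagonalSeries ℂ ^ 24) ModularForm.discriminant := by
  convert X.mul (pentagonalSeries.pow 23) using 1
  ext τ
  rw [discriminant_eq_q_prod,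
    (multipliable_one_sub_pow (mod_cast norm_qParam_lt_one 1 τ)).tprod_pow]
  rfl

end HasQSeries

end QSeries

section LevelOne

open UpperHalfPlane ModularForm ModularFormClass MatrixGroups EisensteinSeries Filter Topology
open scoped Manifold

theorem ModularForm.tendsto_atImInfty {k : ℤ} (f : ModularForm 𝒮ℒ k) :
    Tendsto f atImInfty (𝓝 ((qExpansion 1 f).coeff 0)) := by
  have hanal := ModularFormClass.analyticAt_cuspFunction_zero f one_pos one_mem_strictPeriods_SL
  have hper := SlashInvariantFormClass.periodic_comp_ofComplex f one_mem_strictPeriods_SL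
  rw [qExpansion_coeff_zero one_pos hanal hper, ← cuspFunction_apply_zero one_pos hanal hper]
  exact (hanal.continuousAt.tendsto.comp (qParam_tendsto_atImInfty one_pos)).congr
    (fun τ ↦ SlashInvariantFormClass.eq_cuspFunction f τ one_mem_strictPeriods_SL one_ne_zero)

theorem tendsto_E₄_atImInfty : Tendsto E₄ atImInfty (𝓝 1) := by
  have h := ModularForm.tendsto_atImInfty E₄
  rwa [E_qExpansion_coeff_zero _ ⟨2, rfl⟩] at h

theorem CuspForm.exists_coe_eq {k : ℤ} {f : ℍ → ℂ} (hf : MDiff f)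
    (hS : f ∣[k] ModularGroup.S = f) (hT : f ∣[k] ModularGroup.T = f)
    (h0 : Tendsto f atImInfty (𝓝 0)) : ∃ g : CuspForm 𝒮ℒ k, ⇑g = f :=
  ⟨{ toFun := f
     slash_action_eq' := by
      rintro _ ⟨A, rfl⟩
      exact SlashInvariantForm.slash_action_generators_SL2Z hS hT A
     holo' := hf
     zero_at_cusps' := fun hc ↦ by
      rw [Subgroup.IsArithmetic.isCusp_iff_isCusp_SL2Z] at hc
      rw [OnePoint.isZeroAt_iff_forall_SL2Z hc]
      intro γ _
      rw [SlashInvariantForm.slash_action_generators_SL2Z hS hT]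
      exact h0 }, rfl⟩

theorem eq_zero_of_slash_eq_of_weight_lt_twelve {k : ℤ} (hk : k < 12) {f : ℍ → ℂ} (hf : MDiff f)
    (hS : f ∣[k] ModularGroup.S = f) (hT : f ∣[k] ModularGroup.T = f)
    (h0 : Tendsto f atImInfty (𝓝 0)) : f = 0 := by
  obtain ⟨g, rfl⟩ := CuspForm.exists_coe_eq hf hS hT h0
  rw [rank_zero_iff_forall_zero.mp (CuspForm.rank_eq_zero_of_weight_lt_twelve hk) g]
  rfl

theorem exists_eq_mul_discriminant_of_slash_eq {f : ℍ → ℂ} (hf : MDiff f)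
    (hS : f ∣[(12 : ℤ)] ModularGroup.S = f) (hT : f ∣[(12 : ℤ)] ModularGroup.T = f)
    (h0 : Tendsto f atImInfty (𝓝 0)) : ∃ c : ℂ, ∀ τ, f τ = c * discriminant τ := by
  obtain ⟨g, rfl⟩ := CuspForm.exists_coe_eq hf hS hT h0
  obtain ⟨c, rfl⟩ := CuspForm.exists_smul_discriminant_of_weight_eq_twelve g
  exact ⟨c, fun τ ↦ rfl⟩

theorem E₄_sq_eq_E₈ : (E₄ : ℍ → ℂ) ^ 2 = E (by norm_num : 3 ≤ 8) := by
  let f : ModularForm 𝒮ℒ 8 := ModularForm.mcast (by decide) (E₄.pow 2) - E (by norm_num : 3 ≤ 8)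
  have hf : ⇑f = E₄ ^ 2 - E (by norm_num : 3 ≤ 8) := by
    simp only [f, FunLike.coe_sub, coe_mcast, ModularForm.coe_pow]
  have h := ModularForm.tendsto_atImInfty (E (by norm_num : 3 ≤ 8))
  rw [E_qExpansion_coeff_zero _ ⟨4, rfl⟩] at h
  have h0 : Tendsto f atImInfty (𝓝 0) := by
    rw [hf]
    convert (tendsto_E₄_atImInfty.pow 2).sub h using 2 <;> norm_num
  rw [← sub_eq_zero, ← hf]
  exact eq_zero_of_slash_eq_of_weight_lt_twelve (by norm_num : (8 : ℤ) < 12) f.holo'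
    (f.slash_action_eq' _ ⟨_, rfl⟩) (f.slash_action_eq' _ ⟨_, rfl⟩) h0

/-- The matrix `(a, b; 0, d)` with positive diagonal entries. -/
noncomputable def upperTriangularGL (a b d : ℝ) (h : a * d ≠ 0) : GL (Fin 2) ℝ :=
  Matrix.GeneralLinearGroup.mkOfDetNeZero !![a, b; 0, d] (by simpa using h)

/-- Twice the weight four slash of `E₄` by `g`, for `g` of determinant two. -/
noncomputable def E₄Trans (a b d : ℝ) (h : a * d ≠ 0) : ℍ → ℂ :=
  (2 : ℂ) • ((E₄ : ℍ → ℂ) ∣[(4 : ℤ)] upperTriangularGL a b d h)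

theorem E₄Trans_apply {a b d : ℝ} (h : a * d = 2) (τ : ℍ) :
    E₄Trans a b d (by simp [h]) τ =
      16 * (d : ℂ) ^ (-4 : ℤ) * E₄ (upperTriangularGL a b d (by simp [h]) • τ) := by
  have hdet : (upperTriangularGL a b d (by simp [h])).det.val = 2 := by
    simp [upperTriangularGL, h]
  have hdenom : denom (upperTriangularGL a b d (by simp [h])) τ = d := by
    simp [upperTriangularGL, denom]
  rw [E₄Trans, Pi.smul_apply, slash_apply, hdet, hdenom, σ, hdet]
  norm_num
  ring

theorem E₄_slash (γ : SL(2, ℤ)) : (E₄ : ℍ → ℂ) ∣[(4 : ℤ)] γ = E₄ :=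
  E₄.slash_action_eq' _ ⟨γ, rfl⟩

theorem E₄Trans_slash {a b d a' b' d' : ℝ} (h : a * d ≠ 0) (h' : a' * d' ≠ 0) (γ : SL(2, ℤ))
    (γ' : SL(2, ℤ)) (hγ : upperTriangularGL a b d h * γ = γ' * upperTriangularGL a' b' d' h') :
    E₄Trans a b d h ∣[(4 : ℤ)] γ = E₄Trans a' b' d' h' := by
  rw [E₄Trans, SL_smul_slash, SL_slash, ← SlashAction.slash_mul, hγ, SlashAction.slash_mul,
    ← SL_slash, E₄_slash, E₄Trans]

theorem tendsto_E₄Trans_atImInfty {a b d : ℝ} (h : a * d = 2) :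
    Tendsto (E₄Trans a b d (by simp [h])) atImInfty (𝓝 (16 * (d : ℂ) ^ (-4 : ℤ))) := by
  have h1 := (tendsto_E₄_atImInfty.comp (tendsto_smul_atImInfty
    (g := upperTriangularGL a b d (by simp [h])) (by simp [upperTriangularGL]))).const_mul
    (16 * (d : ℂ) ^ (-4 : ℤ))
  rw [mul_one] at h1
  exact h1.congr fun τ ↦ (E₄Trans_apply h τ).symm

theorem mdifferentiable_E₄Trans {a b d : ℝ} (h : a * d ≠ 0) : MDiff (E₄Trans a b d h) :=
  mdifferentiable_const.mul (E₄.holo'.slash 4 _)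

theorem permuted_forms_relations {v₀ v₁ v₂ : ℍ → ℂ} (hv₀ : MDiff v₀) (hv₁ : MDiff v₁)
    (hv₂ : MDiff v₂) (hS₀ : v₀ ∣[(4 : ℤ)] ModularGroup.S = v₁)
    (hS₁ : v₁ ∣[(4 : ℤ)] ModularGroup.S = v₀) (hS₂ : v₂ ∣[(4 : ℤ)] ModularGroup.S = v₂)
    (hT₀ : v₀ ∣[(4 : ℤ)] ModularGroup.T = v₀) (hT₁ : v₁ ∣[(4 : ℤ)] ModularGroup.T = v₂)
    (hT₂ : v₂ ∣[(4 : ℤ)] ModularGroup.T = v₁) (h₀ : Tendsto v₀ atImInfty (𝓝 15))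
    (h₁ : Tendsto v₁ atImInfty (𝓝 0)) (h₂ : Tendsto v₂ atImInfty (𝓝 0)) :
    ∃ c : ℂ, ∀ τ, v₀ τ ^ 2 * (v₀ τ - 15 * E₄ τ) = c * discriminant τ := by
  have hsum : v₀ + v₁ + v₂ - (15 : ℂ) • (E₄ : ℍ → ℂ) = 0 := by
    refine eq_zero_of_slash_eq_of_weight_lt_twelve (by norm_num : (4 : ℤ) < 12)
      (((hv₀.add hv₁).add hv₂).sub (mdifferentiable_const.mul E₄.holo')) ?_ ?_ ?_
    · rw [sub_eq_add_neg, SlashAction.add_slash, SlashAction.neg_slash, SL_smul_slash,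
        SlashAction.add_slash, SlashAction.add_slash, hS₀, hS₁, hS₂, E₄_slash,
        add_comm v₁]
    · rw [sub_eq_add_neg, SlashAction.add_slash, SlashAction.neg_slash, SL_smul_slash,
        SlashAction.add_slash, SlashAction.add_slash, hT₀, hT₁, hT₂, E₄_slash,
        add_right_comm v₀]
    · convert ((h₀.add h₁).add h₂).sub (tendsto_E₄_atImInfty.const_smul (15 : ℂ)) using 2 <;>
        norm_num
  have hpair : v₀ * v₁ + v₀ * v₂ + v₁ * v₂ = 0 := by
    refine eq_zero_of_slash_eq_of_weight_lt_twelve (by norm_num : (4 + 4 : ℤ) < 12)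
      (((hv₀.mul hv₁).add (hv₀.mul hv₂)).add (hv₁.mul hv₂)) ?_ ?_ ?_
    · simp only [SlashAction.add_slash, mul_slash_SL2, hS₀, hS₁, hS₂]
      ring
    · simp only [SlashAction.add_slash, mul_slash_SL2, hT₀, hT₁, hT₂]
      ring
    · convert ((h₀.mul h₁).add (h₀.mul h₂)).add (h₁.mul h₂) using 2 <;> norm_num
  obtain ⟨c, hc⟩ : ∃ c : ℂ, ∀ τ, (v₀ * v₁ * v₂) τ = c * discriminant τ := by
    refine exists_eq_mul_discriminant_of_slash_eq ((hv₀.mul hv₁).mul hv₂) ?_ ?_ ?_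
    · rw [show (12 : ℤ) = 4 + 4 + 4 by norm_num]
      simp only [mul_slash_SL2, hS₀, hS₁, hS₂]
      ring
    · rw [show (12 : ℤ) = 4 + 4 + 4 by norm_num]
      simp only [mul_slash_SL2, hT₀, hT₁, hT₂]
      ring
    · convert (h₀.mul h₁).mul h₂ using 2 <;> norm_num
  refine ⟨c, fun τ ↦ ?_⟩
  have h1 : v₀ τ + v₁ τ + v₂ τ - 15 * E₄ τ = 0 := congrFun hsum τ
  have h2 : v₀ τ * v₁ τ + v₀ τ * v₂ τ + v₁ τ * v₂ τ = 0 := congrFun hpair τ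
  have h3 : v₀ τ * v₁ τ * v₂ τ = c * discriminant τ := hc τ
  linear_combination h3 + v₀ τ ^ 2 * h1 - v₀ τ * h2

/-- The weight twelve form `(16 E₄(2τ) - E₄(τ))² (E₄(2τ) - E₄(τ))` is a multiple of the
discriminant. -/
theorem exists_E₄_double_relation : ∃ c : ℂ, ∀ τ τ' : ℍ, (τ' : ℂ) = 2 * τ →
    (16 * E₄ τ' - E₄ τ) ^ 2 * (E₄ τ' - E₄ τ) = c * discriminant τ := by
  have hdiff (a b d : ℝ) (h : a * d ≠ 0) : MDiff (E₄Trans a b d h - E₄) :=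
    (mdifferentiable_E₄Trans h).sub E₄.holo'
  have hslash {a b d a' b' d' : ℝ} (h : a * d ≠ 0) (h' : a' * d' ≠ 0) (γ γ' : SL(2, ℤ))
      (hγ : upperTriangularGL a b d h * γ = γ' * upperTriangularGL a' b' d' h') :
      (E₄Trans a b d h - E₄) ∣[(4 : ℤ)] γ = E₄Trans a' b' d' h' - E₄ := by
    rw [sub_eq_add_neg, SlashAction.add_slash, SlashAction.neg_slash, E₄_slash,
      E₄Trans_slash h h' γ γ' hγ, ← sub_eq_add_neg]
  have h₀ : (2 : ℝ) * 1 ≠ 0 := by norm_num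
  have h₁ : (1 : ℝ) * 2 ≠ 0 := by norm_num
  have hlim {a b d : ℝ} (h : a * d = 2) : Tendsto (E₄Trans a b d (by simp [h]) - (E₄ : ℍ → ℂ))
      atImInfty (𝓝 (16 * (d : ℂ) ^ (-4 : ℤ) - 1)) :=
    (tendsto_E₄Trans_atImInfty h).sub tendsto_E₄_atImInfty
  refine Exists.elim (permuted_forms_relations (hdiff 2 0 1 h₀) (hdiff 1 0 2 h₁) (hdiff 1 1 2 h₁)
    (hslash _ _ ModularGroup.S ModularGroup.S ?_) (hslash _ _ ModularGroup.S ModularGroup.S ?_)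
    (hslash _ _ ModularGroup.S
      (ModularGroup.T * ModularGroup.S * ModularGroup.T ^ 2 * ModularGroup.S) ?_)
    (hslash _ _ ModularGroup.T (ModularGroup.T ^ 2) ?_) (hslash _ _ ModularGroup.T 1 ?_)
    (hslash _ _ ModularGroup.T ModularGroup.T ?_) ?_ ?_ ?_) fun c hc ↦ ?_
  rotate_left 6
  · convert hlim (b := 0) (mul_one 2) using 2; norm_num
  · convert hlim (b := 0) (one_mul 2) using 2; norm_num
  · convert hlim (b := 1) (one_mul 2) using 2; norm_num
  · refine ⟨c / 16, fun τ τ' hτ ↦ ?_⟩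
    have h := hc τ
    have hsmul : upperTriangularGL 2 0 1 h₀ • τ = τ' := by
      ext
      rw [UpperHalfPlane.coe_smul_of_det_pos (by simp [upperTriangularGL]), hτ]
      simp [upperTriangularGL, num, denom]
    rw [Pi.sub_apply, E₄Trans_apply (by norm_num), hsmul] at h
    norm_num at h
    linear_combination h / 16
  all_goals
    ext i j
    fin_cases i <;> fin_cases j <;>
      norm_num [upperTriangularGL, Matrix.mul_apply, Fin.sum_univ_two, ModularGroup.coe_S,
        ModularGroup.coe_T, pow_two]

end LevelOne

section EisensteinIdentities

open PowerSeries UpperHalfPlane ModularForm ModularFormClass MatrixGroups EisensteinSeries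

/-- The power series `1 + c ∑ σ k n * X ^ n`, the sum being over positive `n`. -/
noncomputable def sigmaSeries (R : Type*) [CommRing R] (k : ℕ) (c : ℤ) : R⟦X⟧ :=
  mk fun m ↦ if m = 0 then 1 else c * (ArithmeticFunction.sigma k m : R)

theorem map_sigmaSeries {R S : Type*} [CommRing R] [CommRing S] (φ : R →+* S) (k : ℕ) (c : ℤ) :
    (sigmaSeries R k c).map φ = sigmaSeries S k c := by
  ext m
  rw [coeff_map, sigmaSeries, sigmaSeries, coeff_mk, coeff_mk]
  split_ifs <;> simp

theorem coeff_zero_sigmaSeries (R : Type*) [CommRing R] (k : ℕ) (c : ℤ) :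
    coeff 0 (sigmaSeries R k c) = 1 := by
  simp [sigmaSeries]

theorem coeff_one_sigmaSeries (R : Type*) [CommRing R] (k : ℕ) (c : ℤ) :
    coeff 1 (sigmaSeries R k c) = c := by
  simp [sigmaSeries]

theorem hasQSeries_E {k : ℕ} (hk : 3 ≤ k) (hk2 : Even k) {c : ℤ} (hc : -(2 * k) = c * bernoulli k)
    (hb : bernoulli k ≠ 0) : HasQSeries (sigmaSeries ℂ (k - 1) c) (E hk) := fun τ ↦ by
  refine (ModularForm.hasSum_qExpansion (f := E hk) one_pos one_mem_strictPeriods_SL τ).congr_fun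
    fun m ↦ ?_
  have h : -(2 * k / bernoulli k : ℂ) = c := by
    have hb' : (bernoulli k : ℂ) ≠ 0 := mod_cast hb
    rw [← neg_div, div_eq_iff hb']
    exact_mod_cast hc
  rw [E_qExpansion_coeff hk hk2, sigmaSeries, coeff_mk, h, smul_eq_mul]

theorem bernoulli_six : bernoulli 6 = 1 / 42 := by
  have h5 := bernoulli'_eq_zero_of_odd (n := 5) (by decide) (by norm_num)
  rw [bernoulli_eq_bernoulli'_of_ne_one (by norm_num), bernoulli'_def]
  norm_num [Finset.sum_range_succ, Nat.choose, h5]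

theorem bernoulli_eight : bernoulli 8 = -1 / 30 := by
  have h5 := bernoulli'_eq_zero_of_odd (n := 5) (by decide) (by norm_num)
  have h7 := bernoulli'_eq_zero_of_odd (n := 7) (by decide) (by norm_num)
  have h6 := bernoulli_eq_bernoulli'_of_ne_one (n := 6) (by norm_num) ▸ bernoulli_six
  rw [bernoulli_eq_bernoulli'_of_ne_one (by norm_num), bernoulli'_def]
  norm_num [Finset.sum_range_succ, Nat.choose, h5, h6, h7]

theorem hasQSeries_E₄ : HasQSeries (sigmaSeries ℂ 3 240) E₄ := by
  have h : bernoulli 4 = -1 / 30 := by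
    rw [bernoulli_eq_bernoulli'_of_ne_one (by norm_num), bernoulli'_four]
  exact hasQSeries_E _ ⟨2, rfl⟩ (by norm_num [h]) (by norm_num [h])

theorem hasQSeries_E₆ : HasQSeries (sigmaSeries ℂ 5 (-504)) E₆ :=
  hasQSeries_E _ ⟨3, rfl⟩ (by norm_num [bernoulli_six]) (by norm_num [bernoulli_six])

theorem hasQSeries_E₈ : HasQSeries (sigmaSeries ℂ 7 480) (E (by norm_num : 3 ≤ 8)) :=
  hasQSeries_E _ ⟨4, rfl⟩ (by norm_num [bernoulli_eight]) (by norm_num [bernoulli_eight])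

theorem eq_of_map_intCast_complex {a b : ℤ⟦X⟧}
    (h : a.map (Int.castRingHom ℂ) = b.map (Int.castRingHom ℂ)) : a = b :=
  map_injective _ (Int.castRingHom ℂ).injective_int h

theorem sigmaSeries_three_sq (R : Type*) [CommRing R] :
    sigmaSeries R 3 240 ^ 2 = sigmaSeries R 7 480 := by
  have h : sigmaSeries ℤ 3 240 ^ 2 = sigmaSeries ℤ 7 480 := by
    apply eq_of_map_intCast_complex
    rw [map_pow, map_sigmaSeries, map_sigmaSeries]
    exact (E₄_sq_eq_E₈ ▸ hasQSeries_E₄.pow 1).eq hasQSeries_E₈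
  simpa only [map_pow, map_sigmaSeries] using congrArg (map (Int.castRingHom R)) h

theorem sigmaSeries_cube_sub_sq (R : Type*) [CommRing R] :
    sigmaSeries R 3 240 ^ 3 - sigmaSeries R 5 (-504) ^ 2 =
      1728 * (X * pentagonalSeries R ^ 24) := by
  have h : sigmaSeries ℤ 3 240 ^ 3 - sigmaSeries ℤ 5 (-504) ^ 2 =
      1728 * (X * pentagonalSeries ℤ ^ 24) := by
    apply eq_of_map_intCast_complex
    simp only [map_sub, map_pow, map_mul, map_sigmaSeries, map_pentagonalSeries, map_X,
      map_ofNat]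
    have h1 := (hasQSeries_E₄.pow 2).sub (hasQSeries_E₆.pow 1)
    refine h1.eq ?_
    have h2 := HasQSeries.discriminant.C_mul 1728
    rw [map_ofNat] at h2
    convert h2 using 1
    ext τ
    rw [discriminant_eq_E₄_cube_sub_E₆_sq, mul_div_cancel₀ _ (by norm_num)]
    rfl
  simpa only [map_sub, map_pow, map_mul, map_sigmaSeries, map_pentagonalSeries, map_X,
    map_ofNat] using congrArg (map (Int.castRingHom R)) h

theorem sigmaSeries_expand_two_relation (R : Type*) [CommRing R] :
    (16 * expand 2 two_ne_zero (sigmaSeries R 3 240) - sigmaSeries R 3 240) ^ 2 *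
        (sigmaSeries R 3 240 - expand 2 two_ne_zero (sigmaSeries R 3 240)) =
      54000 * (X * pentagonalSeries R ^ 24) := by
  have h : (16 * expand 2 two_ne_zero (sigmaSeries ℤ 3 240) - sigmaSeries ℤ 3 240) ^ 2 *
        (sigmaSeries ℤ 3 240 - expand 2 two_ne_zero (sigmaSeries ℤ 3 240)) =
      54000 * (X * pentagonalSeries ℤ ^ 24) := by
    apply eq_of_map_intCast_complex
    simp only [map_sub, map_pow, map_mul, map_expand, map_sigmaSeries, map_pentagonalSeries,
      map_X, map_ofNat]
    obtain ⟨c, hc⟩ := exists_E₄_double_relation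
    let g : ℍ → ℂ := fun τ ↦ E₄ ⟨2 * τ, by simpa using τ.2⟩
    have hg : HasQSeries (expand 2 two_ne_zero (sigmaSeries ℂ 3 240)) g :=
      hasQSeries_E₄.expand_two fun τ τ' hτ ↦ congrArg E₄ (UpperHalfPlane.ext hτ.symm)
    have h1 := (((hg.C_mul 16).sub hasQSeries_E₄).pow 1).mul (hasQSeries_E₄.sub hg)
    have hfg : ((fun τ ↦ 16 * g τ) - ⇑E₄) ^ (1 + 1) * (⇑E₄ - g) =
        fun τ ↦ -c * ModularForm.discriminant τ := by
      ext τ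
      have h := hc τ ⟨2 * τ, by simpa using τ.2⟩ rfl
      simp only [Pi.mul_apply, Pi.pow_apply, Pi.sub_apply, g]
      linear_combination -h
    have h2 := (hfg ▸ h1).eq (HasQSeries.discriminant.C_mul (-c))
    have hQ : constantCoeff (sigmaSeries ℂ 3 240) = 1 := by
      rw [← coeff_zero_eq_constantCoeff_apply, coeff_zero_sigmaSeries]
    have hexp0 : constantCoeff (expand 2 two_ne_zero (sigmaSeries ℂ 3 240)) = 1 := by
      rw [constantCoeff_expand, hQ]
    have hexp1 : coeff 1 (expand 2 two_ne_zero (sigmaSeries ℂ 3 240)) = 0 :=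
      coeff_expand_of_not_dvd _ _ _ (by norm_num)
    have hP : constantCoeff (pentagonalSeries ℂ) = 1 := by
      rw [← coeff_zero_eq_constantCoeff_apply, coeff_zero_pentagonalSeries]
    have hc' : c = -54000 := by
      have h3 := congrArg (coeff 1) h2
      simp only [coeff_one_mul, map_sub, map_mul, map_pow, constantCoeff_C, hexp0, hexp1, hQ, hP,
        coeff_one_sigmaSeries, coeff_C_mul, coeff_one_X, constantCoeff_X] at h3
      norm_num at h3
      linear_combination h3
    rw [hc', map_ofNat, neg_neg, map_ofNat] at h2
    exact h2
  simpa only [map_sub, map_pow, map_mul, map_expand, map_sigmaSeries, map_pentagonalSeries,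
    map_X, map_ofNat] using congrArg (map (Int.castRingHom R)) h

end EisensteinIdentities

section CubicPartition

open PowerSeries

theorem natCast_sigma_seven_eq (m : ℕ) :
    (ArithmeticFunction.sigma 7 m : ZMod 7) = ArithmeticFunction.sigma 1 m := by
  have : Fact (Nat.Prime 7) := ⟨by norm_num⟩
  simp [ArithmeticFunction.sigma_apply, ZMod.pow_card (p := 7)]

theorem eulerDerivation_pentagonalSeries_mod_seven :
    eulerDerivation (ZMod 7) (pentagonalSeries (ZMod 7)) =
      5 * (sigmaSeries (ZMod 7) 3 240 ^ 2 - 1) * pentagonalSeries (ZMod 7) := by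
  have h : 5 * (sigmaSeries (ZMod 7) 7 480 - 1) =
      -mk fun n => (ArithmeticFunction.sigma 1 n : ZMod 7) := by
    ext m
    have h5 : (5 : (ZMod 7)⟦X⟧) = C 5 := (map_ofNat C 5).symm
    rw [h5, coeff_C_mul, map_sub, map_neg, coeff_mk, sigmaSeries, coeff_mk, coeff_one]
    split_ifs with hm
    · simp [hm]
    · rw [natCast_sigma_seven_eq, sub_zero, ← mul_assoc, ← neg_one_mul]
      rfl
  rw [sigmaSeries_three_sq, h, eulerDerivation_pentagonalSeries]
  ring

theorem sigmaSeries_five_mod_seven : sigmaSeries (ZMod 7) 5 (-504) = 1 := by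
  ext m
  rw [sigmaSeries, coeff_mk, coeff_one]
  split_ifs
  · rfl
  · rw [show ((-504 : ℤ) : ZMod 7) = 0 from rfl, zero_mul]

end CubicPartition

theorem cubicPartition_mod_seven_15 (n : ℕ) : 7 ∣ cubicPartition (49 * n + 15) := by
  rw [← ZMod.natCast_eq_zero_iff]
  have h7 : (7 : PowerSeries (ZMod 7)) = 0 := by
    exact_mod_cast CharP.cast_eq_zero (PowerSeries (ZMod 7)) 7
  have h := coeff_eq_zero_of_ramanujan_mod_seven (Q := sigmaSeries (ZMod 7) 3 240)
    eulerDerivation_pentagonalSeries_mod_seven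
    (by
      have h := sigmaSeries_cube_sub_sq (ZMod 7)
      rw [sigmaSeries_five_mod_seven] at h
      linear_combination h + 247 * PowerSeries.X * PowerSeries.pentagonalSeries (ZMod 7) ^ 24 * h7)
    (by
      have h := sigmaSeries_expand_two_relation (ZMod 7)
      set Q := sigmaSeries (ZMod 7) 3 240
      set E := PowerSeries.expand 2 two_ne_zero Q
      linear_combination h + (7714 * (PowerSeries.X * PowerSeries.pentagonalSeries (ZMod 7) ^ 24) -
        (4 * E * (2 * E - Q) + 28 * E ^ 2) * (Q - E)) * h7)
    (coeff_zero_sigmaSeries _ _ _) (coeff_one_sigmaSeries _ _ _)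
    (coeff_zero_pentagonalSeries _) (mk_cubicPartition_mul_eq_one _) n
  rwa [PowerSeries.coeff_mk] at h
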